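/- In the stationary process of the DSS, the particle fillings at distinct sites are uncorrelated in time: for all sites x ≠ x' in {1,…,L}, all t ≥ 0 and all τ ≥ 1, Cov(z(x,t), z(x',t+τ)) = 0. -/

import Mathlib

namespace DSS

/-- A state of the DSS on `L` sites: a stable field `z : Fin L → Bool` together with a
finite multiset `w` of waiting particles (particles past site `L` have left the system). -/
structure State (L : ℕ) where
  z : Fin L → Bool
  w : Multiset (Fin L)

variable {L : ℕ}

/-- The multiset holding the right neighbour of `x`; empty if the particle leaves the system. -/
def succSite (L : ℕ) (x : Fin L) : Multiset (Fin L) :=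
  if h : x.val + 1 < L then {(⟨x.val + 1, h⟩ : Fin L)} else 0

/-- Evolution of a waiting particle at `x` when `z x = 1`: the waiting particle moves to
`x+1` and the stable particle at `x` becomes a waiting particle at `x`. -/
def topple (s : State L) (x : Fin L) : State L :=
  ⟨Function.update s.z x false, s.w + succSite L x⟩

/-- Evolution of a waiting particle at `x` when `z x = 0`, settling branch (probability p). -/
def settle (s : State L) (x : Fin L) : State L :=
  ⟨Function.update s.z x true, s.w.erase x⟩

/-- Evolution of a waiting particle at `x` when `z x = 0`, jumping branch (probability q). -/
def jump (s : State L) (x : Fin L) : State L :=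
  ⟨s.z, s.w.erase x + succSite L x⟩

/-- `stabilizeAux p q R n s c` is the probability that, evolving one waiting particle at a
time (the particle being selected by the rule `R`), the process started from `s` reaches
within `n` elementary steps a stable state whose stable field is `c`. -/
noncomputable def stabilizeAux (p q : ℝ) (R : State L → Option (Fin L)) :
    ℕ → State L → (Fin L → Bool) → ℝ
  | 0, s, c => if s.w = 0 ∧ s.z = c then 1 else 0
  | n + 1, s, c =>
    match R s with
    | none => if s.z = c then 1 else 0
    | some x =>
      if s.z x then stabilizeAux p q R n (topple s x) c
      else p * stabilizeAux p q R n (settle s x) c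
        + q * stabilizeAux p q R n (jump s x) c

/-- The canonical evolution rule: evolve the leftmost waiting particle. -/
def minRule (s : State L) : Option (Fin L) :=
  if h : s.w = 0 then none
  else some (s.w.toFinset.min'
    (Finset.nonempty_iff_ne_empty.mpr (by simpa [Multiset.toFinset_eq_empty] using h)))

/-- A termination measure: the stabilization process started from `s` ends after at most
`fuel s` elementary steps, whatever the rule and the randomness. -/
def potential (s : State L) : ℕ :=
  (s.w.map fun x => L + 1 - x.val).sum + ∑ x : Fin L, (if s.z x then L + 1 - x.val else 0)

def fuel (s : State L) : ℕ := 2 * potential s + Multiset.card s.w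

/-- Add one waiting particle at site `1` (index `0`). -/
def addGrain (r : Fin L → Bool) : State L :=
  ⟨r, if h : 0 < L then {(⟨0, h⟩ : Fin L)} else 0⟩

/-- The driven-dissipative transition kernel `W` of the DSS: add a particle at site 1 and
stabilize. -/
noncomputable def Wker (p q : ℝ) (r r' : Fin L → Bool) : ℝ :=
  stabilizeAux p q minRule (fuel (addGrain r)) (addGrain r) r'

/-- `W` as a matrix on stable configurations. -/
noncomputable def Wmat (p q : ℝ) (L : ℕ) :
    Matrix (Fin L → Bool) (Fin L → Bool) ℝ :=
  Matrix.of fun r r' => Wker p q r r'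

/-- The product Bernoulli(p) measure `ψ(r) = p^(Σ r) q^(L - Σ r)`. -/
noncomputable def psi (p q : ℝ) {L : ℕ} (r : Fin L → Bool) : ℝ :=
  p ^ (Finset.univ.filter fun x => r x = true).card *
    q ^ (L - (Finset.univ.filter fun x => r x = true).card)


/-- `E[z(x,t)]` in the stationary process. -/
noncomputable def meanZ (p q : ℝ) (L : ℕ) (t : ℕ) (x : Fin L) : ℝ :=
  ∑ r0 : Fin L → Bool, ∑ r1 : Fin L → Bool,
    psi p q r0 * ((Wmat p q L) ^ t) r0 r1 * (if r1 x then 1 else 0)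

/-- `Cov(z(x,t), z(x',t+τ))` in the stationary process. -/
noncomputable def covZ (p q : ℝ) (L : ℕ) (t τ : ℕ) (x x' : Fin L) : ℝ :=
  (∑ r0 : Fin L → Bool, ∑ r1 : Fin L → Bool, ∑ r2 : Fin L → Bool,
      psi p q r0 * ((Wmat p q L) ^ t) r0 r1 * (if r1 x then 1 else 0) *
        ((Wmat p q L) ^ τ) r1 r2 * (if r2 x' then 1 else 0))
    - meanZ p q L t x * meanZ p q L (t + τ) x'

/-- Expectation of `f` over the stable field reached from `s` within `n` elementary steps. -/
noncomputable def stabExp (p q : ℝ) (n : ℕ) (f : (Fin L → Bool) → ℝ) (s : State L) : ℝ :=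
  ∑ c, stabilizeAux p q minRule n s c * f c

/-- The centred filling at site `k`. -/
def centered (p : ℝ) (k : Fin L) (z : Fin L → Bool) : ℝ := (if z k then 1 else 0) - p

/-- Observables of the form `g(z₁, …, z_{k-1}) (z_k - p)`. -/
def IsInnovation (p : ℝ) (k : Fin L) (f : (Fin L → Bool) → ℝ) : Prop :=
  ∃ g : (Fin L → Bool) → ℝ, (∀ z z', (∀ i < k, z i = z' i) → g z = g z') ∧
    ∀ z, f z = g z * centered p k z

section Fuel

lemma mem_succSite {x y : Fin L} : y ∈ succSite L x ↔ y.val = x.val + 1 := by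
  unfold succSite
  split_ifs with h
  · simp [Fin.ext_iff]
  · simp only [Multiset.notMem_zero, false_iff]
    omega

lemma card_succSite_le (x : Fin L) : Multiset.card (succSite L x) ≤ 1 := by
  unfold succSite
  split_ifs <;> simp

lemma sum_succSite_lt (x : Fin L) :
    ((succSite L x).map fun y => L + 1 - y.val).sum + 1 ≤ L + 1 - x.val := by
  unfold succSite
  have := x.isLt
  split_ifs <;> simp <;> omega

lemma sum_field_update (z : Fin L → Bool) (x : Fin L) (b : Bool) (c : Fin L → ℕ) :
    (∑ y, if Function.update z x b y then c y else 0) + (if z x then c x else 0) =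
      (∑ y, if z y then c y else 0) + (if b then c x else 0) := by
  rw [← Finset.add_sum_erase _ _ (Finset.mem_univ x),
    ← Finset.add_sum_erase _ (fun y => if z y then c y else 0) (Finset.mem_univ x)]
  have : ∑ y ∈ Finset.univ.erase x, (if Function.update z x b y then c y else 0) =
      ∑ y ∈ Finset.univ.erase x, (if z y then c y else 0) :=
    Finset.sum_congr rfl fun y hy => by
      rw [Function.update_of_ne (Finset.ne_of_mem_erase hy)]
  rw [this, Function.update_self]
  ring

lemma sum_map_erase {w : Multiset (Fin L)} {x : Fin L} (hx : x ∈ w) (c : Fin L → ℕ) :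
    ((w.erase x).map c).sum + c x = (w.map c).sum := by
  conv_rhs => rw [← Multiset.cons_erase hx]
  simp [add_comm]

lemma fuel_mk (z : Fin L → Bool) (w : Multiset (Fin L)) :
    fuel ⟨z, w⟩ = 2 * ((w.map fun y => L + 1 - y.val).sum +
      ∑ y, if z y then L + 1 - y.val else 0) + Multiset.card w := rfl

lemma fuel_topple_lt (s : State L) {x : Fin L} (hz : s.z x = true) :
    fuel (topple s x) < fuel s := by
  have h1 := sum_succSite_lt x
  have h2 := card_succSite_le x
  have h3 := sum_field_update s.z x false (fun y => L + 1 - y.val)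
  simp only [hz, if_true, Bool.false_eq_true, if_false] at h3
  change fuel ⟨Function.update s.z x false, s.w + succSite L x⟩ < fuel ⟨s.z, s.w⟩
  simp only [fuel_mk, Multiset.map_add, Multiset.sum_add, Multiset.card_add]
  omega

lemma fuel_settle_lt (s : State L) {x : Fin L} (hx : x ∈ s.w) (hz : s.z x = false) :
    fuel (settle s x) < fuel s := by
  have h1 := sum_map_erase hx (fun y => L + 1 - y.val)
  have h2 := Multiset.card_erase_add_one hx
  have h3 := sum_field_update s.z x true (fun y => L + 1 - y.val)
  simp only [hz, if_true, Bool.false_eq_true, if_false] at h3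
  change fuel ⟨Function.update s.z x true, s.w.erase x⟩ < fuel ⟨s.z, s.w⟩
  simp only [fuel_mk]
  omega

lemma fuel_jump_lt (s : State L) {x : Fin L} (hx : x ∈ s.w) :
    fuel (jump s x) < fuel s := by
  have h0 := sum_map_erase hx (fun y => L + 1 - y.val)
  have h1 := sum_succSite_lt x
  have h2 := card_succSite_le x
  have h3 := Multiset.card_erase_add_one hx
  change fuel ⟨s.z, s.w.erase x + succSite L x⟩ < fuel ⟨s.z, s.w⟩
  simp only [fuel_mk, Multiset.map_add, Multiset.sum_add, Multiset.card_add]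
  omega

end Fuel

section Stabilization

variable {p q : ℝ}

lemma stabExp_of_stable (n : ℕ) (f : (Fin L → Bool) → ℝ) {s : State L} (hw : s.w = 0) :
    stabExp p q n f s = f s.z := by
  cases n <;> simp [stabExp, stabilizeAux, minRule, hw]

lemma stabExp_step {n : ℕ} (f : (Fin L → Bool) → ℝ) {s : State L} (hw : s.w ≠ 0)
    (hn : fuel s ≤ n) :
    ∃ x ∈ s.w, (∀ y ∈ s.w, x ≤ y) ∧ ∃ m < n,
      (s.z x = true ∧ stabExp p q n f s = stabExp p q m f (topple s x) ∧
        fuel (topple s x) ≤ m) ∨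
      (s.z x = false ∧
        stabExp p q n f s = p * stabExp p q m f (settle s x) + q * stabExp p q m f (jump s x) ∧
        fuel (settle s x) ≤ m ∧ fuel (jump s x) ≤ m) := by
  have hne : s.w.toFinset.Nonempty :=
    Finset.nonempty_iff_ne_empty.mpr (by simpa [Multiset.toFinset_eq_empty] using hw)
  have hrule : minRule s = some (s.w.toFinset.min' hne) := by simp [minRule, hw]
  have hx : s.w.toFinset.min' hne ∈ s.w := by
    simpa using s.w.toFinset.min'_mem hne
  refine ⟨_, hx, fun y hy => s.w.toFinset.min'_le y (by simpa using hy), n - 1, ?_, ?_⟩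
  · have := Multiset.card_pos.mpr hw
    unfold fuel at hn
    omega
  set x := s.w.toFinset.min' hne
  cases hz : s.z x with
  | true =>
    have := fuel_topple_lt s hz
    obtain ⟨m, rfl⟩ : ∃ m, n = m + 1 := ⟨n - 1, by omega⟩
    refine Or.inl ⟨rfl, ?_, by omega⟩
    simp [stabExp, stabilizeAux, hrule, hz]
  | false =>
    have h1 := fuel_settle_lt s hx hz
    have h2 := fuel_jump_lt s hx
    obtain ⟨m, rfl⟩ : ∃ m, n = m + 1 := ⟨n - 1, by omega⟩
    refine Or.inr ⟨rfl, ?_, by omega, by omega⟩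
    simp [stabExp, stabilizeAux, hrule, hz, add_mul, Finset.sum_add_distrib, Finset.mul_sum,
      mul_assoc]

lemma forall_mem_add {P : Fin L → Prop} {w w' : Multiset (Fin L)} (h : ∀ y ∈ w, P y)
    (h' : ∀ y ∈ w', P y) : ∀ y ∈ w + w', P y :=
  fun y hy => (Multiset.mem_add.mp hy).elim (h y) (h' y)

lemma le_of_mem_succSite {k : ℕ} {x : Fin L} (hx : k ≤ x.val) :
    ∀ y ∈ succSite L x, k ≤ y.val :=
  fun y hy => by rw [mem_succSite.mp hy]; omega

/-- Waiting particles at sites `≥ k` do not affect the field at sites `< k`. -/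
lemma stabExp_eq_of_forall_le (hpq : p + q = 1) {f : (Fin L → Bool) → ℝ} {k : ℕ}
    (hf : ∀ z z', (∀ i : Fin L, i.val < k → z i = z' i) → f z = f z') (n : ℕ) :
    ∀ s : State L, (∀ y ∈ s.w, k ≤ y.val) → fuel s ≤ n → stabExp p q n f s = f s.z := by
  induction n using Nat.strong_induction_on with
  | _ n ih =>
  intro s hs hn
  by_cases hw : s.w = 0
  · exact stabExp_of_stable n f hw
  obtain ⟨x, hx, -, m, hmn, ⟨-, h, hm⟩ | ⟨-, h, hm, hm'⟩⟩ :=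
    stabExp_step (p := p) (q := q) f hw hn
  · rw [h, ih m hmn _ (forall_mem_add hs (le_of_mem_succSite (hs x hx))) hm]
    exact hf _ _ fun i hi => Function.update_of_ne (by have := hs x hx; grind) _ _
  · rw [h, ih m hmn _ (fun y hy => hs y (Multiset.mem_of_mem_erase hy)) hm,
      ih m hmn _ (forall_mem_add (fun y hy => hs y (Multiset.mem_of_mem_erase hy))
        (le_of_mem_succSite (hs x hx))) hm']
    have : f (settle s x).z = f s.z :=
      hf _ _ fun i hi => Function.update_of_ne (by have := hs x hx; grind) _ _
    rw [this, show (jump s x).z = s.z from rfl, ← add_mul, hpq, one_mul]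

lemma IsInnovation.congr {k : Fin L} {f : (Fin L → Bool) → ℝ} (hf : IsInnovation p k f)
    {z z' : Fin L → Bool} (h : ∀ i ≤ k, z i = z' i) : f z = f z' := by
  obtain ⟨g, hg, hfg⟩ := hf
  rw [hfg, hfg, hg z z' fun i hi => h i hi.le, centered, centered, h k le_rfl]

/-- A waiting particle at `k` refreshes the filling of `k`, so that innovations average out. -/
lemma stabExp_eq_zero_of_mem (hpq : p + q = 1) {f : (Fin L → Bool) → ℝ} {k : Fin L}
    (hf : IsInnovation p k f) (n : ℕ) :
    ∀ s : State L, k ∈ s.w → fuel s ≤ n → stabExp p q n f s = 0 := by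
  induction n using Nat.strong_induction_on with
  | _ n ih =>
  intro s hk hn
  have hw : s.w ≠ 0 := fun h => by simp [h] at hk
  obtain ⟨x, hx, hmin, m, hmn, ⟨-, h, hm⟩ | ⟨hz, h, hm, hm'⟩⟩ :=
    stabExp_step (p := p) (q := q) f hw hn
  · rw [h, ih m hmn _ (Multiset.mem_add.mpr (Or.inl hk)) hm]
  by_cases hke : k ∈ s.w.erase x
  · rw [h, ih m hmn _ hke hm, ih m hmn _ (Multiset.mem_add.mpr (Or.inl hke)) hm']
    ring
  obtain rfl : k = x := by
    by_contra hne
    exact hke ((Multiset.mem_erase_of_ne hne).mpr hk)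
  have hlt : ∀ y ∈ s.w.erase k, k.val + 1 ≤ y.val := fun y hy => by
    have h1 := hmin y (Multiset.mem_of_mem_erase hy)
    have h2 : k ≠ y := fun e => hke (e ▸ hy)
    omega
  have hdep : ∀ z z' : Fin L → Bool, (∀ i : Fin L, i.val < k.val + 1 → z i = z' i) →
      f z = f z' := fun z z' hzz => hf.congr fun i hi => hzz i (by omega)
  rw [h, stabExp_eq_of_forall_le hpq hdep m (settle s k) hlt hm,
    stabExp_eq_of_forall_le hpq hdep m (jump s k)
      (fun y hy => (Multiset.mem_add.mp hy).elim (hlt y) fun hy' =>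
        (mem_succSite.mp hy').ge) hm']
  obtain ⟨g, hg, hfg⟩ := hf
  have hgs : g (settle s k).z = g s.z :=
    hg _ _ fun i hi => Function.update_of_ne hi.ne _ _
  have h1 : centered p k (settle s k).z = 1 - p := by simp [centered, settle]
  have h0 : centered p k (jump s k).z = -p := by simp [centered, jump, hz]
  rw [hfg, hfg, hgs, h1, h0, show (jump s k).z = s.z from rfl]
  linear_combination (-(p * g s.z)) * hpq

/-- Up to the first visit to `k`, an innovation at `k` keeps its factor `z_k - p`. -/
lemma stabExp_mul_centered (hpq : p + q = 1) {f : (Fin L → Bool) → ℝ} {k : Fin L}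
    (hf : IsInnovation p k f) (n : ℕ) :
    ∀ (n' : ℕ) (s s' : State L), s.w = s'.w → (∀ i < k, s.z i = s'.z i) →
      fuel s ≤ n → fuel s' ≤ n' →
      stabExp p q n f s * centered p k s'.z = stabExp p q n' f s' * centered p k s.z := by
  induction n using Nat.strong_induction_on with
  | _ n ih =>
  intro n' s s' hww hzz hn hn'
  by_cases hk : k ∈ s.w
  · rw [stabExp_eq_zero_of_mem hpq hf n s hk hn,
      stabExp_eq_zero_of_mem hpq hf n' s' (hww ▸ hk) hn', zero_mul, zero_mul]
  by_cases hall : ∀ y ∈ s.w, k.val + 1 ≤ y.val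
  · have hdep : ∀ z z' : Fin L → Bool, (∀ i : Fin L, i.val < k.val + 1 → z i = z' i) →
        f z = f z' := fun z z' hzz => hf.congr fun i hi => hzz i (by omega)
    rw [stabExp_eq_of_forall_le hpq hdep n s hall hn,
      stabExp_eq_of_forall_le hpq hdep n' s' (hww ▸ hall) hn']
    obtain ⟨g, hg, hfg⟩ := hf
    rw [hfg, hfg, hg _ _ hzz]
    ring
  have hw : s.w ≠ 0 := fun h => hall fun y hy => by simp [h] at hy
  obtain ⟨x, hx, hmin, m, hmn, hstep⟩ := stabExp_step (p := p) (q := q) f hw hn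
  obtain ⟨x', hx', hmin', m', -, hstep'⟩ :=
    stabExp_step (p := p) (q := q) f (hww ▸ hw : s'.w ≠ 0) hn'
  obtain rfl : x = x' := le_antisymm (hmin x' (hww ▸ hx')) (hmin' x (hww ▸ hx))
  have hxk : x < k := by
    push Not at hall
    obtain ⟨y, hy, hyk⟩ := hall
    have h1 := hmin y hy
    have h2 : x ≠ k := fun e => hk (e ▸ hx)
    omega
  have hupd : ∀ b, ∀ i < k, Function.update s.z x b i = Function.update s'.z x b i :=
    fun b i hi => by
      by_cases hix : i = x
      · simp [hix]
      · simp [hix, hzz i hi]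
  have hcen : ∀ (z : Fin L → Bool) b, centered p k (Function.update z x b) = centered p k z :=
    fun z b => by simp [centered, Function.update_of_ne hxk.ne']
  have hzx := hzz x hxk
  obtain ⟨hz, h, hm⟩ | ⟨hz, h, hm1, hm2⟩ := hstep <;>
    obtain ⟨hz', h', hm'⟩ | ⟨hz', h', hm1', hm2'⟩ := hstep' <;> simp [hz, hz'] at hzx
  · have := ih m hmn m' (topple s x) (topple s' x) (by simp [topple, hww]) (hupd _) hm hm'
    simp only [topple, hcen] at this
    rw [h, h']
    exact this
  · have h1 := ih m hmn m' (settle s x) (settle s' x) (by simp [settle, hww]) (hupd _) hm1 hm1'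
    have h2 := ih m hmn m' (jump s x) (jump s' x) (by simp [jump, hww]) hzz hm2 hm2'
    simp only [settle, hcen] at h1
    rw [h, h']
    simp only [settle, jump] at h1 h2 ⊢
    linear_combination p * h1 + q * h2

end Stabilization

section Kernel

variable {p q : ℝ}

open Matrix

lemma Wmat_pow_mulVec_const (hpq : p + q = 1) (a : ℝ) (t : ℕ) :
    (Wmat p q L ^ t) *ᵥ (fun _ => a) = fun _ => a := by
  induction t with
  | zero => simp
  | succ t ih =>
    have hW : Wmat p q L *ᵥ (fun _ => a) = fun _ => a := funext fun r =>
      stabExp_eq_of_forall_le (k := 0) hpq (fun _ _ _ => rfl) _ _ (fun _ _ => Nat.zero_le _)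
        le_rfl
    rw [pow_succ, ← mulVec_mulVec, hW, ih]

lemma IsInnovation.Wmat_mulVec (hq : q ≠ 0) (hpq : p + q = 1) {k : Fin L}
    {f : (Fin L → Bool) → ℝ} (hf : IsInnovation p k f) :
    IsInnovation p k (Wmat p q L *ᵥ f) := by
  have hq' : ∀ z : Fin L → Bool, centered p k (Function.update z k true) = q := fun z => by
    simp [centered, ← hpq]
  have key : ∀ z z' : Fin L → Bool, (∀ i < k, z i = z' i) →
      (Wmat p q L *ᵥ f) z * centered p k z' = (Wmat p q L *ᵥ f) z' * centered p k z :=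
    fun z z' h => stabExp_mul_centered hpq hf _ _ (addGrain z) (addGrain z') rfl h le_rfl le_rfl
  refine ⟨fun z => (Wmat p q L *ᵥ f) (Function.update z k true) / q, fun z z' h => ?_,
    fun z => ?_⟩
  · have := key (Function.update z k true) (Function.update z' k true) fun i hi => by
      simp [hi.ne, h i hi]
    rw [hq', hq'] at this
    exact congrArg (· / q) (mul_right_cancel₀ hq this)
  · have := key z (Function.update z k true) fun i hi => by simp [hi.ne]
    rw [hq'] at this
    field_simp
    exact this

lemma IsInnovation.Wmat_pow_mulVec (hq : q ≠ 0) (hpq : p + q = 1) {k : Fin L}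
    {f : (Fin L → Bool) → ℝ} (hf : IsInnovation p k f) (t : ℕ) :
    IsInnovation p k ((Wmat p q L ^ t) *ᵥ f) := by
  induction t with
  | zero => simpa using hf
  | succ t ih =>
    rw [pow_succ', ← mulVec_mulVec]
    exact ih.Wmat_mulVec hq hpq

lemma isInnovation_centered (k : Fin L) : IsInnovation p k (centered p k) :=
  ⟨fun _ => 1, fun _ _ _ => rfl, fun _ => (one_mul _).symm⟩

lemma IsInnovation.mul_left {k : Fin L} {f g : (Fin L → Bool) → ℝ} (hf : IsInnovation p k f)
    (hg : ∀ z z', (∀ i < k, z i = z' i) → g z = g z') :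
    IsInnovation p k (fun z => g z * f z) := by
  obtain ⟨g', hg', hf⟩ := hf
  exact ⟨fun z => g z * g' z, fun z z' h => congrArg₂ _ (hg z z' h) (hg' z z' h),
    fun z => by simp only [hf, mul_assoc]⟩

end Kernel

section Stationary

variable {p q : ℝ}

open Matrix

lemma psi_eq_prod (r : Fin L → Bool) : psi p q r = ∏ i, if r i then p else q := by
  have h := Finset.card_filter_add_card_filter_not (s := (Finset.univ : Finset (Fin L)))
    (fun i => r i = true)
  rw [Finset.card_univ, Fintype.card_fin] at h
  rw [psi, Finset.prod_ite, Finset.prod_const, Finset.prod_const]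
  congr 2
  omega

lemma sum_psi (hpq : p + q = 1) : ∑ r : Fin L → Bool, psi p q r = 1 := by
  simp_rw [psi_eq_prod]
  have h := Finset.prod_univ_sum (fun _ : Fin L => (Finset.univ : Finset Bool))
    (fun _ b => if b = true then p else q)
  rw [Fintype.piFinset_univ] at h
  rw [← h]
  simp [hpq]

lemma psi_dotProduct_innovation (hpq : p + q = 1) {k : Fin L} {f : (Fin L → Bool) → ℝ}
    (hf : IsInnovation p k f) : psi p q ⬝ᵥ f = 0 := by
  obtain ⟨g, hg, hf⟩ := hf
  refine Finset.sum_involution (fun r _ => Function.update r k (!r k)) (fun r _ => ?_)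
    (fun r _ _ h => ?_) (fun _ _ => Finset.mem_univ _) (fun r _ => ?_)
  · have hprod : ∏ i ∈ Finset.univ.erase k,
        (if Function.update r k (!r k) i then p else q) =
        ∏ i ∈ Finset.univ.erase k, if r i then p else q :=
      Finset.prod_congr rfl fun i hi => by
        rw [Function.update_of_ne (Finset.ne_of_mem_erase hi)]
    have hgr : g (Function.update r k (!r k)) = g r :=
      hg _ _ fun i hi => Function.update_of_ne hi.ne _ _
    rw [hf, hf, hgr, psi_eq_prod, psi_eq_prod,
      ← Finset.mul_prod_erase _ _ (Finset.mem_univ k),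
      ← Finset.mul_prod_erase _ (fun i => if Function.update r k (!r k) i then p else q)
        (Finset.mem_univ k), hprod]
    obtain rfl : q = 1 - p := by linarith
    cases h : r k <;> simp [centered, h] <;> ring
  · have := congrFun h k
    simp at this
  · simp

/-- Expectation of `f` under the law of the stationary process at time `t`. -/
noncomputable def expectAt (p q : ℝ) (t : ℕ) (f : (Fin L → Bool) → ℝ) : ℝ :=
  psi p q ⬝ᵥ ((Wmat p q L ^ t) *ᵥ f)

lemma expectAt_add (t : ℕ) (f g : (Fin L → Bool) → ℝ) :
    expectAt p q t (fun z => f z + g z) = expectAt p q t f + expectAt p q t g := by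
  rw [expectAt, expectAt, expectAt, ← dotProduct_add, ← mulVec_add]
  rfl

lemma expectAt_const_mul (t : ℕ) (a : ℝ) (f : (Fin L → Bool) → ℝ) :
    expectAt p q t (fun z => a * f z) = a * expectAt p q t f := by
  rw [expectAt, expectAt, ← smul_eq_mul, ← dotProduct_smul, ← mulVec_smul]
  rfl

lemma expectAt_const (hpq : p + q = 1) (t : ℕ) (a : ℝ) :
    expectAt p q t (fun _ : Fin L → Bool => a) = a := by
  rw [expectAt, Wmat_pow_mulVec_const hpq, dotProduct, ← Finset.sum_mul, sum_psi hpq, one_mul]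

lemma IsInnovation.expectAt_eq_zero (hq : q ≠ 0) (hpq : p + q = 1) {k : Fin L}
    {f : (Fin L → Bool) → ℝ} (hf : IsInnovation p k f) (t : ℕ) : expectAt p q t f = 0 :=
  psi_dotProduct_innovation hpq (hf.Wmat_pow_mulVec hq hpq t)

lemma meanZ_eq (hq : q ≠ 0) (hpq : p + q = 1) (t : ℕ) (x : Fin L) : meanZ p q L t x = p := by
  have h : meanZ p q L t x = expectAt p q t fun z => centered p x z + p := by
    simp [meanZ, expectAt, dotProduct, mulVec, centered, Finset.mul_sum]
  rw [h, expectAt_add, expectAt_const hpq, (isInnovation_centered x).expectAt_eq_zero hq hpq,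
    zero_add]

/-- At a fixed time, innovations at `k` are uncorrelated with the filling of any other site. -/
lemma IsInnovation.expectAt_mul_centered (hq : q ≠ 0) (hpq : p + q = 1) {k x : Fin L}
    (hxk : x ≠ k) {f : (Fin L → Bool) → ℝ} (hf : IsInnovation p k f) (t : ℕ) :
    expectAt p q t (fun z => centered p x z * f z) = 0 := by
  rcases hxk.lt_or_gt with h | h
  · exact (hf.mul_left fun z z' hz => by simp [centered, hz x h]).expectAt_eq_zero hq hpq t
  · have hx : IsInnovation p x fun z => f z * centered p x z :=
      (isInnovation_centered x).mul_left fun z z' hz =>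
        hf.congr fun i hi => hz i (hi.trans_lt h)
    simpa only [mul_comm] using hx.expectAt_eq_zero hq hpq t

end Stationary

open scoped Matrix

/-- in the stationary process the particle fillings at distinct sites are
uncorrelated in time: `Cov(z(x,t), z(x',t+τ)) = 0` for `x ≠ x'`, `t ≥ 0`, `τ ≥ 1`. -/
theorem distinct_sites_fillings_uncorrelated
    (L : ℕ) (hL : 0 < L) (p q : ℝ) (hp : 0 < p) (hq : 0 < q) (hpq : p + q = 1)
    (x x' : Fin L) (hxx' : x ≠ x') (t τ : ℕ) (hτ : 1 ≤ τ) :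
    covZ p q L t τ x x' = 0 := by
  set F := (Wmat p q L ^ τ) *ᵥ centered p x' with hF
  have hFin : IsInnovation p x' F := (isInnovation_centered x').Wmat_pow_mulVec hq.ne' hpq τ
  have hind : ((Wmat p q L ^ τ) *ᵥ fun z => if z x' then (1 : ℝ) else 0) = fun z => F z + p := by
    have : (fun z : Fin L → Bool => if z x' then (1 : ℝ) else 0) =
        centered p x' + fun _ => p := by
      funext z
      simp [centered]
    rw [this, Matrix.mulVec_add, Wmat_pow_mulVec_const hpq]
    rfl
  have hjoint : (∑ r0 : Fin L → Bool, ∑ r1 : Fin L → Bool, ∑ r2 : Fin L → Bool,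
      psi p q r0 * ((Wmat p q L) ^ t) r0 r1 * (if r1 x then 1 else 0) *
        ((Wmat p q L) ^ τ) r1 r2 * (if r2 x' then 1 else 0)) =
      expectAt p q t fun z => (centered p x z * F z + p * F z) + (p * centered p x z + p * p) := by
    have hsplit : (fun z => (centered p x z * F z + p * F z) + (p * centered p x z + p * p)) =
        fun z => (if z x then (1 : ℝ) else 0) *
          ((Wmat p q L ^ τ) *ᵥ fun z => if z x' then (1 : ℝ) else 0) z := by
      funext z
      rw [hind, centered]
      ring
    rw [hsplit]
    simp only [expectAt, dotProduct, Matrix.mulVec, Finset.mul_sum, mul_assoc]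
  rw [covZ, hjoint, meanZ_eq hq.ne' hpq, meanZ_eq hq.ne' hpq, expectAt_add, expectAt_add,
    expectAt_add, expectAt_const_mul, expectAt_const_mul, expectAt_const hpq,
    hFin.expectAt_mul_centered hq.ne' hpq hxx', hFin.expectAt_eq_zero hq.ne' hpq,
    (isInnovation_centered x).expectAt_eq_zero hq.ne' hpq]
  ring

end DSS
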